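/- Let G be a group, K a positive integer, A ⊆ G a K-approximate subgroup, and μ a finitely additive measure on the subsets of G, invariant under left translation by every element of ⟨A⟩, with μ(A) = 1. If B ⊆ A^n for some n < ω and μ(B) > 0, then B·B⁻¹ is symmetric and A is covered by finitely many left translates of B·B⁻¹, i.e. there is a finite set Z ⊆ A with A ⊆ Z·(B·B⁻¹). -/

import Mathlib

open scoped Pointwise ENNReal

/-- A subset of a group is symmetric if it contains 1 and is closed under inverse. -/
def IsSymmetric {G : Type*} [Group G] (A : Set G) : Prop :=
  (1 : G) ∈ A ∧ ∀ a ∈ A, a⁻¹ ∈ A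

/-- A symmetric subset `A` is a `K`-approximate subgroup if `A·A ⊆ E·A`
for some finite `E` with `|E| ≤ K`. -/
def IsApproxSubgroup {G : Type*} [Group G] (K : ℕ) (A : Set G) : Prop :=
  IsSymmetric A ∧ ∃ E : Finset G, E.card ≤ K ∧ A * A ⊆ (E : Set G) * A

/-- A finitely additive measure on all subsets of `G`, with values in `[0,∞]`. -/
def IsFinAddMeasure {G : Type*} [Group G] (μ : Set G → ℝ≥0∞) : Prop :=
  μ ∅ = 0 ∧ ∀ X Y : Set G, Disjoint X Y → μ (X ∪ Y) = μ X + μ Y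

theorem fam_mono {G : Type*} [Group G] {μ : Set G → ℝ≥0∞} (hμ : IsFinAddMeasure μ)
    {X Y : Set G} (h : X ⊆ Y) : μ X ≤ μ Y := by
  have := hμ.2 X (Y \ X) Set.disjoint_sdiff_right
  rw [Set.union_diff_cancel h] at this
  rw [this]
  exact le_self_add

theorem fam_union_le {G : Type*} [Group G] {μ : Set G → ℝ≥0∞} (hμ : IsFinAddMeasure μ)
    (X Y : Set G) : μ (X ∪ Y) ≤ μ X + μ Y := by
  rw [← Set.union_diff_self, hμ.2 X (Y \ X) Set.disjoint_sdiff_right]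
  gcongr
  exact fam_mono hμ Set.diff_subset

theorem fam_finite {G : Type*} [Group G] {μ : Set G → ℝ≥0∞} (hμ : IsFinAddMeasure μ)
    {A : Set G} (hinv : ∀ g ∈ Subgroup.closure A, ∀ X : Set G, μ (g • X) = μ X)
    (hμA : μ A = 1) {F : Set G} (hF : F.Finite) :
    F ⊆ Subgroup.closure A → μ (F * A) < ⊤ := by
  induction F, hF using Set.Finite.induction_on with
  | empty => intro _; simp [hμ.1]
  | @insert f F _ _ ih =>
    intro h
    rw [Set.insert_subset_iff] at h
    rw [Set.insert_eq, Set.union_mul, Set.singleton_mul]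
    refine (fam_union_le hμ _ _).trans_lt (ENNReal.add_lt_top.2 ⟨?_, ih h.2⟩)
    have := hinv f h.1 A
    rw [hμA] at this
    change μ ((fun x => f * x) '' A) = 1 at this
    rw [this]
    simp

theorem approx_pow {G : Type*} [Group G] {K : ℕ} {A : Set G} (hA : IsApproxSubgroup K A)
    (n : ℕ) : ∃ F : Set G, F.Finite ∧ F ⊆ Subgroup.closure A ∧ A ^ (n + 1) ⊆ F * A := by
  obtain ⟨-, E, -, hE⟩ := hA
  induction n with
  | zero => exact ⟨{1}, Set.finite_singleton _, by simp [one_mem], by simp⟩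
  | succ n ih =>
    obtain ⟨F, hF, hFA, hs⟩ := ih
    refine ⟨F * ((E : Set G) ∩ Subgroup.closure A),
      hF.mul (E.finite_toSet.subset Set.inter_subset_left), ?_, ?_⟩
    · rintro _ ⟨f, hf, e, he, rfl⟩
      exact mul_mem (hFA hf) he.2
    · rw [pow_succ]
      rintro _ ⟨x, hx, a, ha, rfl⟩
      obtain ⟨f, hf, b, hb, rfl⟩ := hs hx
      obtain ⟨e, he, c, hc, hec⟩ := hE (Set.mul_mem_mul hb ha)
      simp only at hec
      refine ⟨f * e, ⟨f, hf, e, ⟨he, ?_⟩, rfl⟩, c, hc, ?_⟩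
      · have : e = b * a * c⁻¹ := by rw [← hec]; group
        rw [this]
        exact mul_mem (mul_mem (Subgroup.subset_closure hb) (Subgroup.subset_closure ha))
          (inv_mem (Subgroup.subset_closure hc))
      · simp only [mul_assoc, hec]

/-- If `B ⊆ Aⁿ` has positive measure, then `B·B⁻¹` is symmetric and finitely many left
translates of `B·B⁻¹` by elements of `A` cover `A`. -/
theorem positive_measure_gives_wide_symmetric_set {G : Type*} [Group G]
    (K : ℕ) (hK : 0 < K) (A : Set G) (hA : IsApproxSubgroup K A)
    (μ : Set G → ℝ≥0∞) (hμ : IsFinAddMeasure μ)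
    (hinv : ∀ g ∈ Subgroup.closure A, ∀ X : Set G, μ (g • X) = μ X)
    (hμA : μ A = 1)
    (B : Set G) (n : ℕ) (hB : B ⊆ A ^ n) (hμB : 0 < μ B) :
    IsSymmetric (B * B⁻¹) ∧
      ∃ Z : Finset G, (Z : Set G) ⊆ A ∧ A ⊆ (Z : Set G) * (B * B⁻¹) := by
  obtain ⟨b₀, hb₀⟩ : B.Nonempty := by
    by_contra h
    rw [Set.not_nonempty_iff_eq_empty] at h
    rw [h, hμ.1] at hμB
    exact lt_irrefl _ hμB
  refine ⟨⟨⟨b₀, hb₀, b₀⁻¹, by simpa using hb₀, by simp⟩, ?_⟩, ?_⟩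
  · rintro _ ⟨x, hx, y, hy, rfl⟩
    exact ⟨y⁻¹, hy, x⁻¹, by simpa using hx, by simp⟩
  by_contra hcon
  push Not at hcon
  have key : ∀ m : ℕ, ∃ Z : Finset G, (Z : Set G) ⊆ A ∧ μ ((Z : Set G) * B) = m * μ B := by
    intro m
    induction m with
    | zero => exact ⟨∅, by simp, by simp [hμ.1]⟩
    | succ m ih =>
      classical
      obtain ⟨Z, hZA, hZ⟩ := ih
      obtain ⟨a, ha, hna⟩ := Set.not_subset.1 (hcon Z hZA)
      refine ⟨insert a Z, ?_, ?_⟩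
      · rw [Finset.coe_insert]
        exact Set.insert_subset ha hZA
      · have hd : Disjoint (a • B) ((Z : Set G) * B) := by
          rw [Set.disjoint_left]
          rintro _ ⟨b, hb, rfl⟩ ⟨z, hz, c, hc, h⟩
          apply hna
          refine ⟨z, hz, c * b⁻¹, ⟨c, hc, b⁻¹, by simpa using hb, rfl⟩, ?_⟩
          simp only [smul_eq_mul] at h ⊢
          rw [← mul_assoc, h]; group
        have he : ((insert a Z : Finset G) : Set G) * B = a • B ∪ (Z : Set G) * B := by
          rw [Finset.coe_insert, Set.insert_eq, Set.union_mul, Set.singleton_mul]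
          rfl
        rw [he, hμ.2 _ _ hd, hZ, hinv a (Subgroup.subset_closure ha)]
        push_cast
        ring
  obtain ⟨F, hF, hFA, hs⟩ := approx_pow hA n
  have hfin := fam_finite hμ hinv hμA hF hFA
  obtain ⟨m, hm⟩ := ENNReal.exists_nat_mul_gt hμB.ne' hfin.ne
  obtain ⟨Z, hZA, hZ⟩ := key m
  rw [← hZ] at hm
  refine absurd hm (not_lt.2 (fam_mono hμ (Set.Subset.trans ?_ hs)))
  rw [pow_succ']
  exact Set.mul_subset_mul hZA hB
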